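/- arXiv:2103.05982 — 10 statements merged into one kernel-verified Lean document; each statement's English description precedes it below -/
import Mathlib

section
/- Proposition (canonical energy of the linearised theory, adapted coordinates): Suppose the coefficient fields P, Q, R are independent of the coordinate x^0 (stationary background) and φ̃ : (Fin n → ℝ) → (Fin m → ℝ) is a smooth solution of the linearised field equations Ẽ_A(φ̃) = 0. Then for every μ ∈ Fin n and every point x, the linearised Noether current decomposes as H̃^μ = (1/2) ω^μ(φ̃, ∂_0 φ̃) + (1/2)[ ∂_0( Σ_A π̃_A^μ(φ̃) φ̃^A ) − δ^μ_0 Σ_σ ∂_σ( Σ_A π̃_A^σ(φ̃) φ̃^A ) ]; that is, the Hamiltonian current of the linearised theory equals half the presymplectic current evaluated on (φ̃, ∂_0 φ̃) plus the boundary term ∂_σ( X^{[σ} π̃_A^{μ]} φ̃^A ) with X = ∂_0. -/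
/-!
Statement 0: for a linearised (quadratic) field theory on `ℝ^n` in coordinates
adapted to the symmetry `X = ∂₀` (stationary coefficient fields `P`, `Q`, `R`),
the Noether current of a solution of the linearised field equations decomposes
as half the presymplectic current evaluated on `(φ̃, ∂₀φ̃)` plus the boundary
term `∂_σ(X^{[σ}π̃_A^{μ]}φ̃^A)`.
-/

noncomputable section

open scoped BigOperators

/-- Partial derivative of a real-valued function on `Fin n → ℝ` along coordinate `i`. -/
def pd {n : ℕ} (i : Fin n) (f : (Fin n → ℝ) → ℝ) (x : Fin n → ℝ) : ℝ :=
  fderiv ℝ f x (Pi.single i 1)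

variable {m n : ℕ}

/-- Linearised momenta `π̃_A^μ(φ̃) = Σ_{B,ν} P^{AμBν} ∂_νφ̃^B + Σ_B Q^{AμB} φ̃^B`. -/
def linMom (P : (Fin n → ℝ) → (Fin m × Fin n) → (Fin m × Fin n) → ℝ)
    (Q : (Fin n → ℝ) → (Fin m × Fin n) → Fin m → ℝ)
    (φ : (Fin n → ℝ) → (Fin m → ℝ)) (A : Fin m) (μ : Fin n) (x : Fin n → ℝ) : ℝ :=
  (∑ B, ∑ ν, P x (A, μ) (B, ν) * pd ν (fun y => φ y B) x)
    + ∑ B, Q x (A, μ) B * φ x B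

/-- Linearised field momentum `π̃_A(φ̃) = Σ_{B,ν} Q^{BνA} ∂_νφ̃^B + Σ_B R^{AB} φ̃^B`. -/
def linMomF (Q : (Fin n → ℝ) → (Fin m × Fin n) → Fin m → ℝ)
    (R : (Fin n → ℝ) → Fin m → Fin m → ℝ)
    (φ : (Fin n → ℝ) → (Fin m → ℝ)) (A : Fin m) (x : Fin n → ℝ) : ℝ :=
  (∑ B, ∑ ν, Q x (B, ν) A * pd ν (fun y => φ y B) x) + ∑ B, R x A B * φ x B

/-- Quadratic Lagrangian density
`L̃ = (1/2) Σ_{A,μ} π̃_A^μ ∂_μφ̃^A + (1/2) Σ_A π̃_A φ̃^A`. -/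
def linLag (P : (Fin n → ℝ) → (Fin m × Fin n) → (Fin m × Fin n) → ℝ)
    (Q : (Fin n → ℝ) → (Fin m × Fin n) → Fin m → ℝ)
    (R : (Fin n → ℝ) → Fin m → Fin m → ℝ)
    (φ : (Fin n → ℝ) → (Fin m → ℝ)) (x : Fin n → ℝ) : ℝ :=
  (1/2) * (∑ A, ∑ μ, linMom P Q φ A μ x * pd μ (fun y => φ y A) x)
    + (1/2) * ∑ A, linMomF Q R φ A x * φ x A

/-- Linearised Euler–Lagrange expressions `Ẽ_A = Σ_μ ∂_μ π̃_A^μ − π̃_A`. -/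
def linEL (P : (Fin n → ℝ) → (Fin m × Fin n) → (Fin m × Fin n) → ℝ)
    (Q : (Fin n → ℝ) → (Fin m × Fin n) → Fin m → ℝ)
    (R : (Fin n → ℝ) → Fin m → Fin m → ℝ)
    (φ : (Fin n → ℝ) → (Fin m → ℝ)) (A : Fin m) (x : Fin n → ℝ) : ℝ :=
  (∑ μ, pd μ (linMom P Q φ A μ) x) - linMomF Q R φ A x

/-- Noether current `H̃^μ = Σ_A π̃_A^μ ∂₀φ̃^A − δ^μ₀ L̃`. -/
def linNoether [NeZero n]
    (P : (Fin n → ℝ) → (Fin m × Fin n) → (Fin m × Fin n) → ℝ)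
    (Q : (Fin n → ℝ) → (Fin m × Fin n) → Fin m → ℝ)
    (R : (Fin n → ℝ) → Fin m → Fin m → ℝ)
    (φ : (Fin n → ℝ) → (Fin m → ℝ)) (μ : Fin n) (x : Fin n → ℝ) : ℝ :=
  (∑ A, linMom P Q φ A μ x * pd 0 (fun y => φ y A) x)
    - (if μ = 0 then linLag P Q R φ x else 0)

/-- Presymplectic current `ω^μ(u,v) = Σ_A (v^A π̃_A^μ(u) − u^A π̃_A^μ(v))`. -/
def presymp (P : (Fin n → ℝ) → (Fin m × Fin n) → (Fin m × Fin n) → ℝ)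
    (Q : (Fin n → ℝ) → (Fin m × Fin n) → Fin m → ℝ)
    (u v : (Fin n → ℝ) → (Fin m → ℝ)) (μ : Fin n) (x : Fin n → ℝ) : ℝ :=
  ∑ A, (v x A * linMom P Q u A μ x - u x A * linMom P Q v A μ x)

/-- Product rule for coordinate partial derivatives. -/
theorem pd_mul {i : Fin n} {f g : (Fin n → ℝ) → ℝ} {x : Fin n → ℝ}
    (hf : DifferentiableAt ℝ f x) (hg : DifferentiableAt ℝ g x) :
    pd i (fun y => f y * g y) x = pd i f x * g x + f x * pd i g x := by
  simp only [pd, fderiv_fun_mul hf hg, add_apply, smul_apply, smul_eq_mul]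
  ring

/-- Sum rule for coordinate partial derivatives. -/
theorem pd_add {i : Fin n} {f g : (Fin n → ℝ) → ℝ} {x : Fin n → ℝ}
    (hf : DifferentiableAt ℝ f x) (hg : DifferentiableAt ℝ g x) :
    pd i (fun y => f y + g y) x = pd i f x + pd i g x := by
  simp [pd, fderiv_fun_add hf hg]

/-- Coordinate partial derivatives commute with finite sums. -/
theorem pd_sum {ι : Type*} [Fintype ι] {i : Fin n} {f : ι → (Fin n → ℝ) → ℝ} {x : Fin n → ℝ}
    (hf : ∀ a, DifferentiableAt ℝ (f a) x) :
    pd i (fun y => ∑ a, f a y) x = ∑ a, pd i (f a) x := by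
  simp [pd, fderiv_fun_sum fun a _ => hf a]

/-- A partial derivative of a smooth function is smooth. -/
theorem contDiff_pd (i : Fin n) {f : (Fin n → ℝ) → ℝ} (hf : ContDiff ℝ (⊤ : ℕ∞) f) :
    ContDiff ℝ (⊤ : ℕ∞) (pd i f) :=
  (hf.fderiv_right (m := (⊤ : ℕ∞)) (by simp)).clm_apply contDiff_const

/-- Partial derivatives of a smooth function commute. -/
theorem pd_comm (i j : Fin n) {f : (Fin n → ℝ) → ℝ} (hf : ContDiff ℝ (⊤ : ℕ∞) f)
    (x : Fin n → ℝ) : pd i (pd j f) x = pd j (pd i f) x := by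
  have hd : DifferentiableAt ℝ (fderiv ℝ f) x :=
    (hf.fderiv_right (m := (⊤ : ℕ∞)) (by simp)).differentiable (by simp) x
  have key (k l : Fin n) :
      pd k (pd l f) x = fderiv ℝ (fderiv ℝ f) x (Pi.single k 1) (Pi.single l 1) := by
    change fderiv ℝ (fun y => fderiv ℝ f y (Pi.single l 1)) x (Pi.single k 1) = _
    rw [fderiv_clm_apply hd (differentiableAt_const _)]
    simp
  rw [key, key]
  exact (hf.contDiffAt.isSymmSndFDerivAt (by simpa using WithTop.coe_le_coe.2 (le_top (a := (2 : ℕ∞))))) _ _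

/-- A differentiable function independent of a coordinate has vanishing partial derivative
along it. -/
theorem pd_eq_zero_of_update {i : Fin n} {f : (Fin n → ℝ) → ℝ} {x : Fin n → ℝ}
    (hf : DifferentiableAt ℝ f x) (h : ∀ t, f (Function.update x i t) = f x) :
    pd i f x = 0 := by
  have hu := hasDerivAt_update x i (x i)
  have hf' : HasFDerivAt f (fderiv ℝ f x) (Function.update x i (x i)) := by
    simpa using hf.hasFDerivAt
  have hc := hf'.comp_hasDerivAt (x i) hu
  exact hc.unique ((hasDerivAt_const (x i) (f x)).congr_of_eventuallyEq
    (Filter.Eventually.of_forall h))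

/-- The linearised momenta of a smooth field are smooth. -/
theorem contDiff_linMom {P : (Fin n → ℝ) → (Fin m × Fin n) → (Fin m × Fin n) → ℝ}
    {Q : (Fin n → ℝ) → (Fin m × Fin n) → Fin m → ℝ} {φ : (Fin n → ℝ) → (Fin m → ℝ)}
    (hP : ∀ a b, ContDiff ℝ (⊤ : ℕ∞) fun y => P y a b)
    (hQ : ∀ a B, ContDiff ℝ (⊤ : ℕ∞) fun y => Q y a B)
    (hφ : ∀ A, ContDiff ℝ (⊤ : ℕ∞) fun y => φ y A) (A : Fin m) (μ : Fin n) :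
    ContDiff ℝ (⊤ : ℕ∞) (linMom P Q φ A μ) :=
  (ContDiff.sum fun B _ => ContDiff.sum fun ν _ => (hP _ _).mul (contDiff_pd ν (hφ B))).add
    (ContDiff.sum fun B _ => (hQ _ _).mul (hφ B))

/-- If the coefficients do not depend on a coordinate, then the linearised momenta commute with
the corresponding partial derivative. -/
theorem pd_linMom {P : (Fin n → ℝ) → (Fin m × Fin n) → (Fin m × Fin n) → ℝ}
    {Q : (Fin n → ℝ) → (Fin m × Fin n) → Fin m → ℝ} {φ : (Fin n → ℝ) → (Fin m → ℝ)}
    (hP : ∀ a b, ContDiff ℝ (⊤ : ℕ∞) fun y => P y a b)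
    (hQ : ∀ a B, ContDiff ℝ (⊤ : ℕ∞) fun y => Q y a B)
    (hφ : ∀ A, ContDiff ℝ (⊤ : ℕ∞) fun y => φ y A) (i : Fin n)
    (hPi : ∀ x t, P (Function.update x i t) = P x)
    (hQi : ∀ x t, Q (Function.update x i t) = Q x)
    (A : Fin m) (μ : Fin n) (x : Fin n → ℝ) :
    pd i (linMom P Q φ A μ) x
      = linMom P Q (fun y A => pd i (fun z => φ z A) y) A μ x := by
  have hd {f : (Fin n → ℝ) → ℝ} (hf : ContDiff ℝ (⊤ : ℕ∞) f) : DifferentiableAt ℝ f x :=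
    hf.differentiable (by simp) x
  have hPd (B : Fin m) (ν : Fin n) :
      ContDiff ℝ (⊤ : ℕ∞) fun y => P y (A, μ) (B, ν) * pd ν (fun z => φ z B) y :=
    (hP _ _).mul (contDiff_pd ν (hφ B))
  have hQd (B : Fin m) : ContDiff ℝ (⊤ : ℕ∞) fun y => Q y (A, μ) B * φ y B :=
    (hQ _ _).mul (hφ B)
  unfold linMom
  rw [pd_add (hd (ContDiff.sum fun B _ => ContDiff.sum fun ν _ => hPd B ν))
    (hd (ContDiff.sum fun B _ => hQd B)),
    pd_sum fun B => hd (ContDiff.sum fun ν _ => hPd B ν), pd_sum fun B => hd (hQd B)]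
  congr 1
  · refine Finset.sum_congr rfl fun B _ => ?_
    rw [pd_sum fun ν => hd (hPd B ν)]
    refine Finset.sum_congr rfl fun ν _ => ?_
    rw [pd_mul (hd (hP _ _)) (hd (contDiff_pd ν (hφ B))),
      pd_eq_zero_of_update (hd (hP _ _)) fun t => by rw [hPi], zero_mul, zero_add]
    exact congrArg _ (pd_comm i ν (hφ B) x)
  · refine Finset.sum_congr rfl fun B _ => ?_
    rw [pd_mul (hd (hQ _ _)) (hd (hφ B)),
      pd_eq_zero_of_update (hd (hQ _ _)) fun t => by rw [hQi], zero_mul, zero_add]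

/-- canonical energy of the linearised theory in adapted coordinates:
`H̃^μ = (1/2)ω^μ(φ̃, ∂₀φ̃)
  + (1/2)[∂₀(Σ_A π̃_A^μ(φ̃)φ̃^A) − δ^μ₀ Σ_σ ∂_σ(Σ_A π̃_A^σ(φ̃)φ̃^A)]`. -/
theorem linearised_noether_decomposition [NeZero n]
    (P : (Fin n → ℝ) → (Fin m × Fin n) → (Fin m × Fin n) → ℝ)
    (Q : (Fin n → ℝ) → (Fin m × Fin n) → Fin m → ℝ)
    (R : (Fin n → ℝ) → Fin m → Fin m → ℝ)
    (hP : ContDiff ℝ (⊤ : ℕ∞) P) (hQ : ContDiff ℝ (⊤ : ℕ∞) Q) (hR : ContDiff ℝ (⊤ : ℕ∞) R)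
    (hPsymm : ∀ x a b, P x a b = P x b a)
    (hRsymm : ∀ x A B, R x A B = R x B A)
    (hP0 : ∀ (x : Fin n → ℝ) (t : ℝ), P (Function.update x 0 t) = P x)
    (hQ0 : ∀ (x : Fin n → ℝ) (t : ℝ), Q (Function.update x 0 t) = Q x)
    (hR0 : ∀ (x : Fin n → ℝ) (t : ℝ), R (Function.update x 0 t) = R x)
    (φ : (Fin n → ℝ) → (Fin m → ℝ)) (hφ : ContDiff ℝ (⊤ : ℕ∞) φ)
    (hEL : ∀ A x, linEL P Q R φ A x = 0)
    (μ : Fin n) (x : Fin n → ℝ) :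
    linNoether P Q R φ μ x
      = (1/2) * presymp P Q φ (fun y A => pd 0 (fun z => φ z A) y) μ x
        + (1/2) * (pd 0 (fun y => ∑ A, linMom P Q φ A μ y * φ y A) x
            - (if μ = 0 then
                ∑ σ, pd σ (fun y => ∑ A, linMom P Q φ A σ y * φ y A) x
              else 0)) := by
  have hP' (a b) : ContDiff ℝ (⊤ : ℕ∞) fun y => P y a b :=
    contDiff_pi.1 (contDiff_pi.1 hP a) b
  have hQ' (a B) : ContDiff ℝ (⊤ : ℕ∞) fun y => Q y a B :=
    contDiff_pi.1 (contDiff_pi.1 hQ a) B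
  have hφ' (A) : ContDiff ℝ (⊤ : ℕ∞) fun y => φ y A := contDiff_pi.1 hφ A
  have hd {f : (Fin n → ℝ) → ℝ} (hf : ContDiff ℝ (⊤ : ℕ∞) f) : DifferentiableAt ℝ f x :=
    hf.differentiable (by simp) x
  have hM (A) (σ) := contDiff_linMom hP' hQ' hφ' A σ
  have hdiv (i σ : Fin n) : pd i (fun y => ∑ A, linMom P Q φ A σ y * φ y A) x
      = ∑ A, (pd i (linMom P Q φ A σ) x * φ x A
          + linMom P Q φ A σ x * pd i (fun y => φ y A) x) := by
    rw [pd_sum fun A => hd ((hM A σ).mul (hφ' A))]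
    exact Finset.sum_congr rfl fun A _ => pd_mul (hd (hM A σ)) (hd (hφ' A))
  have hLag : linLag P Q R φ x
      = (1/2) * ∑ σ, pd σ (fun y => ∑ A, linMom P Q φ A σ y * φ y A) x := by
    have hF (A) : linMomF Q R φ A x = ∑ σ, pd σ (linMom P Q φ A σ) x :=
      (sub_eq_zero.1 (hEL A x)).symm
    simp only [linLag, hdiv, hF]
    rw [Finset.sum_comm (s := (Finset.univ : Finset (Fin n)))]
    simp only [Finset.sum_add_distrib, Finset.sum_mul]
    ring
  have hsum : ∑ A, linMom P Q φ A μ x * pd 0 (fun y => φ y A) x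
      = (1/2) * presymp P Q φ (fun y A => pd 0 (fun z => φ z A) y) μ x
        + (1/2) * pd 0 (fun y => ∑ A, linMom P Q φ A μ y * φ y A) x := by
    rw [hdiv, presymp, ← mul_add, ← Finset.sum_add_distrib, Finset.mul_sum]
    refine Finset.sum_congr rfl fun A _ => ?_
    rw [pd_linMom hP' hQ' hφ' 0 hP0 hQ0]
    ring
  rw [linNoether, hsum, hLag]
  split_ifs <;> ring
end
end

section
/- Let φ : ℝ × ℝ × (Fin n → ℝ) → (Fin m → ℝ) be a smooth two-parameter family of fields, with parameters λ and τ, and for each (λ, τ) let π_A^μ(λ,τ,·) and E_A(λ,τ,·) be the momenta and Euler–Lagrange expressions of the field φ(λ,τ,·). Define the presymplectic current ω^μ := Σ_A ( ∂_τ φ^A · ∂_λ π_A^μ − ∂_λ φ^A · ∂_τ π_A^μ ). Then at every point Σ_μ ∂_μ ω^μ = Σ_A ( ∂_λ E_A · ∂_τ φ^A − ∂_τ E_A · ∂_λ φ^A ). In particular the presymplectic current is divergence-free whenever the linearised field equations ∂_λ E_A = 0 = ∂_τ E_A hold. -/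
/-!
Statement 1: For a smooth first-order Lagrangian `L` and a smooth field `φ`,
the divergence of the Noether (canonical energy) current associated with the
translation `X = ∂₀` equals `Σ_A E_A ∂₀φ^A`.
-/

noncomputable section

open scoped BigOperators

/-- First jet of a field. -/
def jet {m n : ℕ} (φ : (Fin n → ℝ) → (Fin m → ℝ)) (x : Fin n → ℝ) :
    (Fin m → ℝ) × (Fin m → Fin n → ℝ) :=
  (φ x, fun A μ => pd μ (fun y => φ y A) x)

/-- Canonical momentum `π_A^μ`: derivative of `L` with respect to the derivative
slot `φ^A_μ`, evaluated at the first jet of `φ`. -/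
def mom {m n : ℕ} (L : (Fin m → ℝ) × (Fin m → Fin n → ℝ) → ℝ)
    (φ : (Fin n → ℝ) → (Fin m → ℝ)) (A : Fin m) (μ : Fin n) (x : Fin n → ℝ) : ℝ :=
  fderiv ℝ L (jet φ x) (0, Pi.single A (Pi.single μ 1))

/-- `π_A`: derivative of `L` with respect to the field slot `φ^A`, evaluated at
the first jet of `φ`. -/
def momF {m n : ℕ} (L : (Fin m → ℝ) × (Fin m → Fin n → ℝ) → ℝ)
    (φ : (Fin n → ℝ) → (Fin m → ℝ)) (A : Fin m) (x : Fin n → ℝ) : ℝ :=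
  fderiv ℝ L (jet φ x) (Pi.single A 1, 0)

/-- Euler–Lagrange expression `E_A = Σ_μ ∂_μ π_A^μ − π_A`. -/
def EL {m n : ℕ} (L : (Fin m → ℝ) × (Fin m → Fin n → ℝ) → ℝ)
    (φ : (Fin n → ℝ) → (Fin m → ℝ)) (A : Fin m) (x : Fin n → ℝ) : ℝ :=
  (∑ μ, pd μ (mom L φ A μ) x) - momF L φ A x

/-- Noether (canonical energy) current `H^μ = Σ_A π_A^μ ∂₀φ^A − δ^μ₀ L(j(x))`. -/
def noether {m n : ℕ} [NeZero n] (L : (Fin m → ℝ) × (Fin m → Fin n → ℝ) → ℝ)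
    (φ : (Fin n → ℝ) → (Fin m → ℝ)) (μ : Fin n) (x : Fin n → ℝ) : ℝ :=
  (∑ A, mom L φ A μ x * pd 0 (fun y => φ y A) x)
    - (if μ = 0 then L (jet φ x) else 0)

section DirectionalDerivatives

variable {m n : ℕ} {E : Type*} [NormedAddCommGroup E] [NormedSpace ℝ E]

theorem ContDiff.fderiv_apply_const {f : E → ℝ} (hf : ContDiff ℝ (⊤ : ℕ∞) f) (v : E) :
    ContDiff ℝ (⊤ : ℕ∞) (fun p => fderiv ℝ f p v) :=
  (hf.fderiv_right (m := (⊤ : ℕ∞)) (by simp)).clm_apply contDiff_const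

theorem ContDiff.isSymmSndFDerivAt_of_smooth {f : E → ℝ} (hf : ContDiff ℝ (⊤ : ℕ∞) f) (p : E) :
    IsSymmSndFDerivAt ℝ f p :=
  hf.contDiffAt.isSymmSndFDerivAt
    (minSmoothness_of_isRCLikeNormedField.trans_le (WithTop.coe_le_coe.2 (le_top : (2 : ℕ∞) ≤ ⊤)))

theorem ContDiff.fderiv_apply_comm {f : E → ℝ} (hf : ContDiff ℝ (⊤ : ℕ∞) f) (v w p : E) :
    fderiv ℝ (fun q => fderiv ℝ f q v) p w = fderiv ℝ (fun q => fderiv ℝ f q w) p v := by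
  have hd : DifferentiableAt ℝ (fderiv ℝ f) p :=
    (hf.fderiv_right (m := (⊤ : ℕ∞)) (by simp)).differentiable (by simp) p
  rw [fderiv_clm_apply hd (differentiableAt_const v),
    fderiv_clm_apply hd (differentiableAt_const w)]
  simpa using (hf.isSymmSndFDerivAt_of_smooth p).eq w v

theorem fderiv_fderiv_comp_apply {G : Type*} [NormedAddCommGroup G] [NormedSpace ℝ G]
    {L : G → ℝ} (hL : ContDiff ℝ (⊤ : ℕ∞) L) {J : E → G} {p : E}
    (hJ : DifferentiableAt ℝ J p) (w : G) (v : E) :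
    fderiv ℝ (fun q => fderiv ℝ L (J q) w) p v
      = fderiv ℝ (fderiv ℝ L) (J p) (fderiv ℝ J p v) w := by
  have hd : DifferentiableAt ℝ (fderiv ℝ L) (J p) :=
    (hL.fderiv_right (m := (⊤ : ℕ∞)) (by simp)).differentiable (by simp) _
  have hc : fderiv ℝ (fun q => fderiv ℝ L (J q)) p
      = (fderiv ℝ (fderiv ℝ L) (J p)).comp (fderiv ℝ J p) := fderiv_comp p hd hJ
  have hdc : DifferentiableAt ℝ (fun q => fderiv ℝ L (J q)) p := hd.comp p hJ
  rw [fderiv_clm_apply hdc (differentiableAt_const w), hc]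
  simp

/-- Expansion of a linear functional on the jet space in the coordinate directions. -/
theorem clm_jet_expand (B : ((Fin m → ℝ) × (Fin m → Fin n → ℝ)) →L[ℝ] ℝ)
    (w : (Fin m → ℝ) × (Fin m → Fin n → ℝ)) :
    B w = ∑ A, B (Pi.single A 1, 0) * w.1 A
      + ∑ A, ∑ μ, B (0, Pi.single A (Pi.single μ 1)) * w.2 A μ := by
  have hw : w = ∑ A, w.1 A • ((Pi.single A 1, 0) : (Fin m → ℝ) × (Fin m → Fin n → ℝ))
      + ∑ A, ∑ μ, w.2 A μ •
        ((0, Pi.single A (Pi.single μ 1)) : (Fin m → ℝ) × (Fin m → Fin n → ℝ)) := by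
    ext A
    · simp [Prod.fst_sum, Finset.sum_apply, Pi.single_apply]
    · simp [Prod.snd_sum, Finset.sum_apply, Pi.single_apply]
  conv_lhs => rw [hw]
  simp only [map_add, map_sum, map_smul, smul_eq_mul, mul_comm]

theorem fderiv_jet_apply {F : E → Fin m → ℝ} {K : E → Fin m → Fin n → ℝ} {p : E}
    (hF : DifferentiableAt ℝ F p) (hK : DifferentiableAt ℝ K p) (v : E) :
    fderiv ℝ (fun q => (F q, K q)) p v
      = (fun A => fderiv ℝ (fun q => F q A) p v, fun A μ => fderiv ℝ (fun q => K q A μ) p v) := by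
  have hKA (A : Fin m) : DifferentiableAt ℝ (fun q => K q A) p := differentiableAt_pi.1 hK A
  rw [hF.fderiv_prodMk hK]
  refine Prod.ext (funext fun A => ?_) (funext fun A => funext fun μ => ?_)
  · simp [fderiv_pi (differentiableAt_pi.1 hF)]
  · simp only [ContinuousLinearMap.prod_apply]
    rw [fderiv_pi hKA, ContinuousLinearMap.pi_apply,
      fderiv_pi (differentiableAt_pi.1 (hKA A)), ContinuousLinearMap.pi_apply]

/-- The presymplectic divergence identity for a family of fields over a normed space `E`, with
arbitrary directions `a`, `b` (parameters) and `e μ` (spacetime). -/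
theorem presymplectic_divergence_directional
    {L : (Fin m → ℝ) × (Fin m → Fin n → ℝ) → ℝ} (hL : ContDiff ℝ (⊤ : ℕ∞) L)
    {F : E → Fin m → ℝ} (hF : ContDiff ℝ (⊤ : ℕ∞) F) (e : Fin n → E)
    {J : E → (Fin m → ℝ) × (Fin m → Fin n → ℝ)}
    (hJ : J = fun q => (F q, fun A μ => fderiv ℝ (fun r => F r A) q (e μ)))
    {P : Fin m → Fin n → E → ℝ}
    (hP : P = fun A μ q => fderiv ℝ L (J q) (0, Pi.single A (Pi.single μ 1)))
    {Q : Fin m → E → ℝ} (hQ : Q = fun A q => fderiv ℝ L (J q) (Pi.single A 1, 0))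
    (a b p : E) :
    (∑ μ, fderiv ℝ (fun q => ∑ A,
        (fderiv ℝ (fun r => F r A) q b * fderiv ℝ (P A μ) q a
          - fderiv ℝ (fun r => F r A) q a * fderiv ℝ (P A μ) q b)) p (e μ))
      = ∑ A, (fderiv ℝ (fun q => (∑ μ, fderiv ℝ (P A μ) q (e μ)) - Q A q) p a
            * fderiv ℝ (fun r => F r A) p b
          - fderiv ℝ (fun q => (∑ μ, fderiv ℝ (P A μ) q (e μ)) - Q A q) p b
            * fderiv ℝ (fun r => F r A) p a) := by
  have hFA (A : Fin m) : ContDiff ℝ (⊤ : ℕ∞) (fun r => F r A) := contDiff_pi.1 hF A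
  have hK : ContDiff ℝ (⊤ : ℕ∞)
      (fun q => fun (A : Fin m) (μ : Fin n) => fderiv ℝ (fun r => F r A) q (e μ)) :=
    contDiff_pi.2 fun A => contDiff_pi.2 fun μ => (hFA A).fderiv_apply_const (e μ)
  have hJs : ContDiff ℝ (⊤ : ℕ∞) J := hJ ▸ hF.prodMk hK
  have hJd : DifferentiableAt ℝ J p := hJs.differentiable (by simp) p
  have hLJ : ContDiff ℝ (⊤ : ℕ∞) (fun q => fderiv ℝ L (J q)) :=
    (hL.fderiv_right (m := (⊤ : ℕ∞)) (by simp)).comp hJs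
  have hPs (A μ) : ContDiff ℝ (⊤ : ℕ∞) (P A μ) := by
    rw [hP]; exact hLJ.clm_apply contDiff_const
  have hQs (A) : ContDiff ℝ (⊤ : ℕ∞) (Q A) := by
    rw [hQ]; exact hLJ.clm_apply contDiff_const
  have dF (A v) : DifferentiableAt ℝ (fun q => fderiv ℝ (fun r => F r A) q v) p :=
    ((hFA A).fderiv_apply_const v).differentiable (by simp) p
  have dP (A μ v) : DifferentiableAt ℝ (fun q => fderiv ℝ (P A μ) q v) p :=
    ((hPs A μ).fderiv_apply_const v).differentiable (by simp) p
  have dQ (A) : DifferentiableAt ℝ (Q A) p := (hQs A).differentiable (by simp) p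
  have hess (v w : E) : ∑ A, fderiv ℝ (Q A) p v * fderiv ℝ (fun r => F r A) p w
      + ∑ A, ∑ μ, fderiv ℝ (P A μ) p v
          * fderiv ℝ (fun q => fderiv ℝ (fun r => F r A) q w) p (e μ)
      = fderiv ℝ (fderiv ℝ L) (J p) (fderiv ℝ J p v) (fderiv ℝ J p w) := by
    have hw : fderiv ℝ J p w = (fun A => fderiv ℝ (fun r => F r A) p w,
        fun A μ => fderiv ℝ (fun q => fderiv ℝ (fun r => F r A) q (e μ)) p w) := by
      rw [hJ]
      exact fderiv_jet_apply (hF.differentiable (by simp) p) (hK.differentiable (by simp) p) w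
    rw [clm_jet_expand (fderiv ℝ (fderiv ℝ L) (J p) (fderiv ℝ J p v)) (fderiv ℝ J p w), hw]
    simp only [hP, hQ, fderiv_fderiv_comp_apply hL hJd, (hFA _).fderiv_apply_comm w]
  have key := (hess a b).trans (((hL.isSymmSndFDerivAt_of_smooth (J p)).eq _ _).trans (hess b a).symm)
  have hl (μ : Fin n) : fderiv ℝ (fun q => ∑ A,
        (fderiv ℝ (fun r => F r A) q b * fderiv ℝ (P A μ) q a
          - fderiv ℝ (fun r => F r A) q a * fderiv ℝ (P A μ) q b)) p (e μ)
      = ∑ A, (fderiv ℝ (fun r => F r A) p b * fderiv ℝ (fun q => fderiv ℝ (P A μ) q (e μ)) p a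
        + fderiv ℝ (P A μ) p a * fderiv ℝ (fun q => fderiv ℝ (fun r => F r A) q b) p (e μ)
        - (fderiv ℝ (fun r => F r A) p a * fderiv ℝ (fun q => fderiv ℝ (P A μ) q (e μ)) p b
        + fderiv ℝ (P A μ) p b * fderiv ℝ (fun q => fderiv ℝ (fun r => F r A) q a) p (e μ))) := by
    rw [fderiv_fun_sum fun A _ => ((dF A b).fun_mul (dP A μ a)).fun_sub ((dF A a).fun_mul (dP A μ b)),
      _root_.sum_apply]
    refine Finset.sum_congr rfl fun A _ => ?_
    rw [fderiv_fun_sub ((dF A b).fun_mul (dP A μ a)) ((dF A a).fun_mul (dP A μ b)),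
      fderiv_fun_mul (dF A b) (dP A μ a), fderiv_fun_mul (dF A a) (dP A μ b),
      (hPs A μ).fderiv_apply_comm (e μ) a, (hPs A μ).fderiv_apply_comm (e μ) b]
    simp
  have hr (A : Fin m) (v : E) :
      fderiv ℝ (fun q => (∑ μ, fderiv ℝ (P A μ) q (e μ)) - Q A q) p v
        = ∑ μ, fderiv ℝ (fun q => fderiv ℝ (P A μ) q (e μ)) p v - fderiv ℝ (Q A) p v := by
    rw [fderiv_fun_sub (DifferentiableAt.fun_sum fun μ _ => dP A μ (e μ)) (dQ A),
      fderiv_fun_sum fun μ _ => dP A μ (e μ)]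
    simp
  simp only [hl, hr]
  rw [Finset.sum_comm]
  simp only [Finset.sum_add_distrib, Finset.sum_sub_distrib, sub_mul, Finset.sum_mul,
    mul_comm (fderiv ℝ (fun r => F r _) p _)]
  linarith

end DirectionalDerivatives

section Slices

variable {n : ℕ} {f : ℝ × ℝ × (Fin n → ℝ) → ℝ}

theorem pd_slice (hf : Differentiable ℝ f) (l t : ℝ) (x : Fin n → ℝ) (μ : Fin n) :
    pd μ (fun y => f (l, t, y)) x = fderiv ℝ f (l, t, x) (0, 0, Pi.single μ 1) := by
  have hg : HasFDerivAt (fun y : Fin n → ℝ => (l, t, y))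
      ((0 : (Fin n → ℝ) →L[ℝ] ℝ).prod
        ((0 : (Fin n → ℝ) →L[ℝ] ℝ).prod (ContinuousLinearMap.id ℝ _))) x :=
    (hasFDerivAt_const l x).prodMk ((hasFDerivAt_const t x).prodMk (hasFDerivAt_id x))
  have h := (hf (l, t, x)).hasFDerivAt.comp x hg
  exact congrArg (fun T => T (Pi.single μ 1)) h.fderiv

theorem deriv_slice_fst (hf : Differentiable ℝ f) (l t : ℝ) (x : Fin n → ℝ) :
    deriv (fun s => f (s, t, x)) l = fderiv ℝ f (l, t, x) (1, 0, 0) :=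
  ((hf (l, t, x)).hasFDerivAt.comp_hasDerivAt l
    ((hasDerivAt_id l).prodMk (hasDerivAt_const l (t, x)))).deriv

theorem deriv_slice_snd (hf : Differentiable ℝ f) (l t : ℝ) (x : Fin n → ℝ) :
    deriv (fun s => f (l, s, x)) t = fderiv ℝ f (l, t, x) (0, 1, 0) :=
  ((hf (l, t, x)).hasFDerivAt.comp_hasDerivAt t
    ((hasDerivAt_const t l).prodMk ((hasDerivAt_id t).prodMk (hasDerivAt_const t x)))).deriv

end Slices

/-- for a smooth two-parameter family `Φ(λ,τ,·)` of fields, the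
divergence of the presymplectic current
`ω^μ = Σ_A (∂_τΦ^A ∂_λπ_A^μ − ∂_λΦ^A ∂_τπ_A^μ)` equals
`Σ_A (∂_λE_A ∂_τΦ^A − ∂_τE_A ∂_λΦ^A)`; in particular it vanishes whenever the
linearised field equations `∂_λE_A = 0 = ∂_τE_A` hold. -/
theorem presymplectic_divergence {m n : ℕ}
    (L : (Fin m → ℝ) × (Fin m → Fin n → ℝ) → ℝ) (hL : ContDiff ℝ (⊤ : ℕ∞) L)
    (Φ : ℝ → ℝ → (Fin n → ℝ) → (Fin m → ℝ))
    (hΦ : ContDiff ℝ (⊤ : ℕ∞) (fun p : ℝ × ℝ × (Fin n → ℝ) => Φ p.1 p.2.1 p.2.2))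
    (lam tau : ℝ) (x : Fin n → ℝ) :
    (∑ μ, pd μ (fun y => ∑ A,
        (deriv (fun t => Φ lam t y A) tau * deriv (fun l => mom L (Φ l tau) A μ y) lam
          - deriv (fun l => Φ l tau y A) lam * deriv (fun t => mom L (Φ lam t) A μ y) tau)) x)
      = ∑ A, (deriv (fun l => EL L (Φ l tau) A x) lam * deriv (fun t => Φ lam t x A) tau
          - deriv (fun t => EL L (Φ lam t) A x) tau * deriv (fun l => Φ l tau x A) lam) := by
  let F : ℝ × ℝ × (Fin n → ℝ) → Fin m → ℝ := fun p => Φ p.1 p.2.1 p.2.2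
  let e : Fin n → ℝ × ℝ × (Fin n → ℝ) := fun μ => (0, 0, Pi.single μ 1)
  let J : ℝ × ℝ × (Fin n → ℝ) → (Fin m → ℝ) × (Fin m → Fin n → ℝ) :=
    fun q => (F q, fun A μ => fderiv ℝ (fun r => F r A) q (e μ))
  let P : Fin m → Fin n → ℝ × ℝ × (Fin n → ℝ) → ℝ :=
    fun A μ q => fderiv ℝ L (J q) (0, Pi.single A (Pi.single μ 1))
  let Q : Fin m → ℝ × ℝ × (Fin n → ℝ) → ℝ := fun A q => fderiv ℝ L (J q) (Pi.single A 1, 0)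
  have hFA (A : Fin m) : ContDiff ℝ (⊤ : ℕ∞) (fun r => F r A) := contDiff_pi.1 hΦ A
  have dF (A : Fin m) : Differentiable ℝ (fun r => F r A) := (hFA A).differentiable (by simp)
  have hJs : ContDiff ℝ (⊤ : ℕ∞) J := hΦ.prodMk
    (contDiff_pi.2 fun A => contDiff_pi.2 fun μ => (hFA A).fderiv_apply_const (e μ))
  have hLJ : ContDiff ℝ (⊤ : ℕ∞) (fun q => fderiv ℝ L (J q)) :=
    (hL.fderiv_right (m := (⊤ : ℕ∞)) (by simp)).comp hJs
  have hPs (A μ) : ContDiff ℝ (⊤ : ℕ∞) (P A μ) := hLJ.clm_apply contDiff_const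
  have hQs (A) : ContDiff ℝ (⊤ : ℕ∞) (Q A) := hLJ.clm_apply contDiff_const
  have dP (A μ) : Differentiable ℝ (P A μ) := (hPs A μ).differentiable (by simp)
  have jet_eq (l t : ℝ) (y : Fin n → ℝ) : jet (Φ l t) y = J (l, t, y) :=
    Prod.ext rfl (funext fun A => funext fun μ => pd_slice (dF A) l t y μ)
  have mom_eq (l t : ℝ) (A μ) : mom L (Φ l t) A μ = fun y => P A μ (l, t, y) := by
    funext y
    simp only [mom, jet_eq, P]
  have EL_eq (l t : ℝ) (A) (y : Fin n → ℝ) : EL L (Φ l t) A y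
      = (fun q => (∑ μ, fderiv ℝ (P A μ) q (e μ)) - Q A q) (l, t, y) := by
    simp only [EL, mom_eq, pd_slice (dP A _), momF, jet_eq, Q, e]
  have hEs (A) : Differentiable ℝ (fun q => (∑ μ, fderiv ℝ (P A μ) q (e μ)) - Q A q) :=
    ((ContDiff.sum fun μ _ => (hPs A μ).fderiv_apply_const (e μ)).sub
      (hQs A)).differentiable (by simp)
  have dω (μ : Fin n) : Differentiable ℝ (fun q => ∑ A,
      (fderiv ℝ (fun r => F r A) q (0, 1, 0) * fderiv ℝ (P A μ) q (1, 0, 0)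
        - fderiv ℝ (fun r => F r A) q (1, 0, 0) * fderiv ℝ (P A μ) q (0, 1, 0))) :=
    (ContDiff.sum fun A _ =>
      (((hFA A).fderiv_apply_const _).mul ((hPs A μ).fderiv_apply_const _)).sub
        (((hFA A).fderiv_apply_const _).mul ((hPs A μ).fderiv_apply_const _))).differentiable
      (by simp)
  have F_lam (A) (y : Fin n → ℝ) : deriv (fun l => Φ l tau y A) lam
      = fderiv ℝ (fun r => F r A) (lam, tau, y) (1, 0, 0) := deriv_slice_fst (dF A) lam tau y
  have F_tau (A) (y : Fin n → ℝ) : deriv (fun t => Φ lam t y A) tau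
      = fderiv ℝ (fun r => F r A) (lam, tau, y) (0, 1, 0) := deriv_slice_snd (dF A) lam tau y
  simp only [mom_eq, EL_eq, F_lam, F_tau]
  simp only [deriv_slice_fst (dP _ _), deriv_slice_snd (dP _ _), deriv_slice_fst (hEs _),
    deriv_slice_snd (hEs _), pd_slice (dω _)]
  exact presymplectic_divergence_directional hL hΦ e rfl rfl rfl (1, 0, 0) (0, 1, 0) (lam, tau, x)
end
end

section
/- The tensor P built from any symmetric array G satisfies the pair-interchange symmetry P^{α(βγ)δ(εσ)} = P^{δ(εσ)α(βγ)} for all indices α, β, γ, δ, ε, σ ∈ ι, where both sides denote the partial symmetrizations over β ↔ γ and ε ↔ σ. -/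
noncomputable section

open scoped BigOperators

/-- The tensor `P^{αβγδεσ}` of Chruściel–Hoque–Maliborski–Smołka, built from a
(symmetric) array `G` of contravariant metric components. -/
def Ptensor {ι : Type*} (G : ι → ι → ℝ) (α β γ δ ε σ : ι) : ℝ :=
  (1/2) * (G α ε * G δ β * G γ σ + G α ε * G σ β * G γ δ
    - G α δ * G β ε * G σ γ - G α β * G γ δ * G ε σ
    - G β γ * G α ε * G σ δ + G β γ * G α δ * G ε σ)

/-- Partial symmetrization `A^{α(βγ)δ(εσ)}` of a six-index array: average over
the interchanges `β ↔ γ` and `ε ↔ σ`. -/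
def psym {ι : Type*} (A : ι → ι → ι → ι → ι → ι → ℝ) (α β γ δ ε σ : ι) : ℝ :=
  (1/4) * (A α β γ δ ε σ + A α γ β δ ε σ + A α β γ δ σ ε + A α γ β δ σ ε)
/-- pair-interchange symmetry `P^{α(βγ)δ(εσ)} = P^{δ(εσ)α(βγ)}`. -/
theorem Ptensor_pair_interchange {ι : Type*} [Fintype ι] (G : ι → ι → ℝ)
    (hG : ∀ a b, G a b = G b a) (α β γ δ ε σ : ι) :
    psym (Ptensor G) α β γ δ ε σ = psym (Ptensor G) δ ε σ α β γ := by
  simp only [psym, Ptensor]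
  rw [hG β α, hG γ α, hG δ α, hG ε α, hG σ α, hG γ β, hG δ β, hG ε β, hG σ β,
    hG δ γ, hG ε γ, hG σ γ, hG ε δ, hG σ δ, hG σ ε]
  ring
end
end

section
/- The partial symmetrization of P coincides with that of the Wald–Zoupas tensor: P^{α(βγ)δ(εσ)} = P_WZ^{α(βγ)δ(εσ)} for all indices α, β, γ, δ, ε, σ ∈ ι. -/
noncomputable section

open scoped BigOperators

/-- The Wald–Zoupas tensor `P_WZ^{αβγδεσ}`. -/
def PWZ {ι : Type*} (G : ι → ι → ℝ) (α β γ δ ε σ : ι) : ℝ :=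
  G α ε * G σ β * G γ δ - (1/2) * (G α δ * G β ε * G σ γ)
    - (1/2) * (G α β * G γ δ * G ε σ) - (1/2) * (G β γ * G α ε * G σ δ)
    + (1/2) * (G β γ * G α δ * G ε σ)

/-- the partial symmetrization of `P` coincides with that of the
Wald–Zoupas tensor: `P^{α(βγ)δ(εσ)} = P_WZ^{α(βγ)δ(εσ)}`. -/
theorem Ptensor_psym_eq_PWZ_psym {ι : Type*} [Fintype ι] (G : ι → ι → ℝ)
    (hG : ∀ a b, G a b = G b a) (α β γ δ ε σ : ι) :
    psym (Ptensor G) α β γ δ ε σ = psym (PWZ G) α β γ δ ε σ := by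
  simp only [psym, Ptensor, PWZ, hG δ β, hG δ γ, hG σ β, hG σ γ, hG ε β, hG ε γ]
  ring
end
end

section
/- The partial symmetrization of P equals the symmetric part of P̃ under interchange of its two index triples: P^{α(βγ)δ(εσ)} = (1/2)( P̃^{α(βγ)δ(εσ)} + P̃^{δ(εσ)α(βγ)} ) for all indices α, β, γ, δ, ε, σ ∈ ι. -/
noncomputable section

open scoped BigOperators

/-- The tensor `P̃^{αβγδεσ}`. -/
def Ptilde {ι : Type*} (G : ι → ι → ℝ) (α β γ δ ε σ : ι) : ℝ :=
  G α σ * G β ε * G γ δ - G α β * G γ δ * G ε σ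
    + (1/2) * (G α δ * G β γ * G ε σ) - (1/2) * (G α δ * G β σ * G γ ε)

/-- the partial symmetrization of `P` equals the symmetric part of
`P̃` under interchange of its two index triples:
`P^{α(βγ)δ(εσ)} = (1/2)(P̃^{α(βγ)δ(εσ)} + P̃^{δ(εσ)α(βγ)})`. -/
theorem Ptensor_psym_eq_symmetrised_Ptilde {ι : Type*} [Fintype ι] (G : ι → ι → ℝ)
    (hG : ∀ a b, G a b = G b a) (α β γ δ ε σ : ι) :
    psym (Ptensor G) α β γ δ ε σ
      = (1/2) * (psym (Ptilde G) α β γ δ ε σ + psym (Ptilde G) δ ε σ α β γ) := by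
  simp only [psym, Ptensor, Ptilde,
    hG δ α, hG ε α, hG σ α, hG γ β, hG δ β, hG ε β,
    hG σ β, hG δ γ, hG ε γ, hG σ γ, hG ε δ, hG σ δ, hG σ ε]
  ring
end
end

section
/- For every array S : ι → ι → ι → ℝ which is symmetric in its last two indices (S_{αβγ} = S_{αγβ} for all indices), the quadratic contractions of P and P̃ agree: Σ_{α,β,γ,δ,ε,σ} P^{αβγδεσ} S_{αβγ} S_{δεσ} = Σ_{α,β,γ,δ,ε,σ} P̃^{αβγδεσ} S_{αβγ} S_{δεσ}. (In the application S_{αβγ} = ∇_α g_{βγ}, so the kinetic part of the gravitational Lagrangian density can be written with only the four terms of P̃.) -/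
noncomputable section

open scoped BigOperators

/-- The quadratic contraction `Σ A^{αβγδεσ} S_{αβγ} S_{δεσ}`, as a linear map in `A`. -/
def contraction {ι : Type*} [Fintype ι] (S : ι → ι → ι → ℝ) :
    (ι → ι → ι → ι → ι → ι → ℝ) →ₗ[ℝ] ℝ where
  toFun A := ∑ α, ∑ β, ∑ γ, ∑ δ, ∑ ε, ∑ σ, A α β γ δ ε σ * S α β γ * S δ ε σ
  map_add' A B := by simp only [Pi.add_apply, add_mul, Finset.sum_add_distrib]
  map_smul' c A := by
    simp only [Pi.smul_apply, smul_eq_mul, Finset.mul_sum, mul_assoc, RingHom.id_apply]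

theorem contraction_apply {ι : Type*} [Fintype ι] (S : ι → ι → ι → ℝ)
    (A : ι → ι → ι → ι → ι → ι → ℝ) :
    contraction S A =
      ∑ α, ∑ β, ∑ γ, ∑ δ, ∑ ε, ∑ σ, A α β γ δ ε σ * S α β γ * S δ ε σ :=
  rfl

theorem contraction_swap_blocks {ι : Type*} [Fintype ι] (S : ι → ι → ι → ℝ)
    (A : ι → ι → ι → ι → ι → ι → ℝ) :
    contraction S (fun α β γ δ ε σ => A δ ε σ α β γ) = contraction S A := by
  have h (B : ι → ι → ι → ι → ι → ι → ℝ) : contraction S B =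
      ∑ p : ι × ι × ι, ∑ q : ι × ι × ι, B p.1 p.2.1 p.2.2 q.1 q.2.1 q.2.2 *
        S p.1 p.2.1 p.2.2 * S q.1 q.2.1 q.2.2 := by
    simp only [contraction_apply, Fintype.sum_prod_type]
  rw [h, h, Finset.sum_comm]
  simp only [mul_right_comm]

theorem contraction_swap_right {ι : Type*} [Fintype ι] {S : ι → ι → ι → ℝ}
    (hS : ∀ a b c, S a b c = S a c b) (A : ι → ι → ι → ι → ι → ι → ℝ) :
    contraction S (fun α β γ δ ε σ => A α β γ δ σ ε) = contraction S A := by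
  simp only [contraction_apply]
  refine Fintype.sum_congr _ _ fun α => Fintype.sum_congr _ _ fun β =>
    Fintype.sum_congr _ _ fun γ => Fintype.sum_congr _ _ fun δ => ?_
  rw [Finset.sum_comm]
  exact Fintype.sum_congr _ _ fun ε => Fintype.sum_congr _ _ fun σ => by rw [hS δ σ ε]

theorem contraction_swap_left {ι : Type*} [Fintype ι] {S : ι → ι → ι → ℝ}
    (hS : ∀ a b c, S a b c = S a c b) (A : ι → ι → ι → ι → ι → ι → ℝ) :
    contraction S (fun α β γ δ ε σ => A α γ β δ ε σ) = contraction S A := by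
  rw [← contraction_swap_blocks, ← contraction_swap_blocks S A]
  exact contraction_swap_right hS fun α β γ δ ε σ => A δ ε σ α β γ

/-- for any array `S` symmetric in its last two indices, the
quadratic contractions of `P` and `P̃` agree:
`Σ P^{αβγδεσ} S_{αβγ} S_{δεσ} = Σ P̃^{αβγδεσ} S_{αβγ} S_{δεσ}`. -/
theorem Ptensor_contraction_eq_Ptilde_contraction {ι : Type*} [Fintype ι]
    (G : ι → ι → ℝ) (hG : ∀ a b, G a b = G b a)
    (S : ι → ι → ι → ℝ) (hS : ∀ a b c, S a b c = S a c b) :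
    (∑ α, ∑ β, ∑ γ, ∑ δ, ∑ ε, ∑ σ, Ptensor G α β γ δ ε σ * S α β γ * S δ ε σ)
      = ∑ α, ∑ β, ∑ γ, ∑ δ, ∑ ε, ∑ σ, Ptilde G α β γ δ ε σ * S α β γ * S δ ε σ := by
  rw [← contraction_apply, ← contraction_apply]
  let X : ι → ι → ι → ι → ι → ι → ℝ := fun α β γ δ ε σ => G α σ * G β ε * G γ δ
  let Y : ι → ι → ι → ι → ι → ι → ℝ := fun α β γ δ ε σ => G α β * G γ δ * G ε σ
  let Z : ι → ι → ι → ι → ι → ι → ℝ := fun α β γ δ ε σ => G α δ * G β γ * G ε σ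
  let W : ι → ι → ι → ι → ι → ι → ℝ := fun α β γ δ ε σ => G α δ * G β σ * G γ ε
  let X₁ : ι → ι → ι → ι → ι → ι → ℝ := fun α β γ δ ε σ => X α β γ δ σ ε
  let X₂ : ι → ι → ι → ι → ι → ι → ℝ := fun α β γ δ ε σ => X₁ α γ β δ ε σ
  let W₁ : ι → ι → ι → ι → ι → ι → ℝ := fun α β γ δ ε σ => W α β γ δ σ ε
  let Y₁ : ι → ι → ι → ι → ι → ι → ℝ := fun α β γ δ ε σ => Y δ ε σ α β γ
  let Y₂ : ι → ι → ι → ι → ι → ι → ℝ := fun α β γ δ ε σ => Y₁ α β γ δ σ ε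
  have hX₁ : contraction S X₁ = contraction S X := contraction_swap_right hS X
  have hX₂ : contraction S X₂ = contraction S X₁ := contraction_swap_left hS X₁
  have hW₁ : contraction S W₁ = contraction S W := contraction_swap_right hS W
  have hY₁ : contraction S Y₁ = contraction S Y := contraction_swap_blocks S Y
  have hY₂ : contraction S Y₂ = contraction S Y₁ := contraction_swap_right hS Y₁
  have hP : Ptensor G = (1 / 2 : ℝ) • (X₂ + X₁ - W₁ - Y - Y₂ + Z) := by
    funext α β γ δ ε σ
    simp only [Ptensor, X₂, X₁, X, W₁, W, Y₂, Y₁, Y, Z, Pi.smul_apply, Pi.add_apply,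
      Pi.sub_apply, smul_eq_mul]
    rw [hG δ β, hG σ β, hG σ γ, hG σ δ, hG α ε, hG δ σ, hG ε α]
    ring
  have hQ : Ptilde G = X - Y + (1 / 2 : ℝ) • Z - (1 / 2 : ℝ) • W := rfl
  clear_value X₂ W₁ Y₂ X₁ Y₁ X Y Z W
  simp only [hP, hQ, LinearMap.map_add, LinearMap.map_sub, LinearMap.map_smul, smul_eq_mul,
    hX₂, hX₁, hW₁, hY₂, hY₁]
  ring
end
end

section
/- For every α ∈ ι, Σ_{β,γ,δ,ε,σ} P^{αβγδεσ} h_{βγ} T_{δεσ} = (1/2) Σ_{β,γ,δ,ε,σ} ( 2 G^{αε}G^{δβ}G^{γσ} − G^{αδ}G^{βε}G^{σγ} ) h_{βγ} T_{δεσ}; that is, under the stated trace conditions three of the six terms of P drop out of the presymplectic integrand b^α and the two surviving terms of the first kind combine, yielding the reduced form used for the large-r analysis on null hypersurfaces. -/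
noncomputable section

open scoped BigOperators

/-- for `h` symmetric and `G`-trace-free and `T` symmetric and
`G`-trace-free in its last two indices, three of the six terms of `P` drop out
of the contraction `Σ P^{αβγδεσ} h_{βγ} T_{δεσ}` and the two surviving terms of
the first kind combine:
`Σ P^{αβγδεσ} h_{βγ} T_{δεσ}
  = (1/2) Σ (2G^{αε}G^{δβ}G^{γσ} − G^{αδ}G^{βε}G^{σγ}) h_{βγ} T_{δεσ}`. -/
theorem Ptensor_contraction_reduced {ι : Type*} [Fintype ι]
    (G : ι → ι → ℝ) (hG : ∀ a b, G a b = G b a)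
    (h : ι → ι → ℝ) (hh : ∀ a b, h a b = h b a)
    (hTrace : (∑ β, ∑ γ, G β γ * h β γ) = 0)
    (T : ι → ι → ι → ℝ) (hT : ∀ d e s, T d e s = T d s e)
    (hTtrace : ∀ d, (∑ ε, ∑ σ, G ε σ * T d ε σ) = 0)
    (α : ι) :
    (∑ β, ∑ γ, ∑ δ, ∑ ε, ∑ σ, Ptensor G α β γ δ ε σ * h β γ * T δ ε σ)
      = (1/2) * ∑ β, ∑ γ, ∑ δ, ∑ ε, ∑ σ,
          (2 * (G α ε * G δ β * G γ σ) - G α δ * G β ε * G σ γ) * h β γ * T δ ε σ := by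
  have first_kind :
      (∑ β, ∑ γ, ∑ δ, ∑ ε, ∑ σ, G α ε * G σ β * G γ δ * h β γ * T δ ε σ)
        = ∑ β, ∑ γ, ∑ δ, ∑ ε, ∑ σ, G α ε * G δ β * G γ σ * h β γ * T δ ε σ := by
    rw [Finset.sum_comm]
    refine Finset.sum_congr rfl fun β _ => Finset.sum_congr rfl fun γ _ =>
      Finset.sum_congr rfl fun δ _ => Finset.sum_congr rfl fun ε _ =>
      Finset.sum_congr rfl fun σ _ => ?_
    rw [hG σ γ, hG β δ, hh γ β]
    ring
  have trace_T :
      (∑ β, ∑ γ, ∑ δ, ∑ ε, ∑ σ, G α β * G γ δ * G ε σ * h β γ * T δ ε σ) = 0 := by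
    refine Finset.sum_eq_zero fun β _ => Finset.sum_eq_zero fun γ _ =>
      Finset.sum_eq_zero fun δ _ => ?_
    calc _ = G α β * G γ δ * h β γ * ∑ ε, ∑ σ, G ε σ * T δ ε σ := by
          simp only [Finset.mul_sum]
          refine Finset.sum_congr rfl fun ε _ => Finset.sum_congr rfl fun σ _ => ?_
          ring
      _ = 0 := by rw [hTtrace, mul_zero]
  have trace_h (c : ι → ι → ι → ℝ) :
      (∑ β, ∑ γ, ∑ δ, ∑ ε, ∑ σ, G β γ * c δ ε σ * h β γ * T δ ε σ) = 0 := by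
    calc _ = (∑ β, ∑ γ, G β γ * h β γ) * ∑ δ, ∑ ε, ∑ σ, c δ ε σ * T δ ε σ := by
          simp only [Finset.sum_mul]
          refine Finset.sum_congr rfl fun β _ => Finset.sum_congr rfl fun γ _ => ?_
          simp only [Finset.mul_sum]
          refine Finset.sum_congr rfl fun δ _ => Finset.sum_congr rfl fun ε _ =>
            Finset.sum_congr rfl fun σ _ => ?_
          ring
      _ = 0 := by rw [hTrace, zero_mul]
  have trace_h₁ := trace_h fun δ ε σ => G α ε * G σ δ
  have trace_h₂ := trace_h fun δ ε σ => G α δ * G ε σ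
  simp only [← mul_assoc] at trace_h₁ trace_h₂
  simp only [Ptensor, mul_assoc (1 / 2 : ℝ), mul_assoc (2 : ℝ), add_mul, sub_mul,
    Finset.sum_add_distrib, Finset.sum_sub_distrib, ← Finset.mul_sum]
  linarith
end
end

section
/- Let a, b, c : (0, ∞) → ℝ be smooth and suppose that on (0, ∞): (i) −2 (r·c(r))′ = r^{−2} ( b(r) − (r²·a(r))′ ) (the linearised equation determining the Bondi mass aspect), and (ii) ( r⁴·(r^{−2}·a(r))′ )′ = r²·( r^{−2}·b(r) )′ (the angular divergence of the linearised constraint equation for g_{uA}). Then the function r ↦ r²·c′(r) − a(r) is constant on (0, ∞); equivalently, there exists χ ∈ ℝ with D^A h_{uA} = r² ∂_r h_{uu} + χ for all r > 0. -/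
noncomputable section

open scoped BigOperators

theorem ContDiffOn.hasDerivAt_deriv_of_isOpen {f : ℝ → ℝ} {U : Set ℝ} {n : WithTop ℕ∞}
    (hf : ContDiffOn ℝ n f U) (hU : IsOpen U) (hn : n ≠ 0) {r : ℝ} (hr : r ∈ U) :
    HasDerivAt f (deriv f r) r :=
  ((hf.differentiableOn hn).differentiableAt (hU.mem_nhds hr)).hasDerivAt

/-- A function whose derivative vanishes on a half-line is constant there. -/
theorem exists_eq_const_of_hasDerivAt_zero_Ioi {f : ℝ → ℝ} {x₀ : ℝ}
    (hf : ∀ x ∈ Set.Ioi x₀, HasDerivAt f 0 x) : ∃ k, ∀ x ∈ Set.Ioi x₀, f x = k :=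
  isOpen_Ioi.exists_is_const_of_deriv_eq_zero (convex_Ioi x₀).isPreconnected
    (fun x hx => (hf x hx).differentiableAt.differentiableWithinAt) (fun x hx => (hf x hx).deriv)

/-- radial content of two linearised Bondi–Sachs constraint
equations on a vacuum light cone.  Here `a(r)` stands for `D^A h_{uA}(r)`,
`b(r)` for `D^A D^B h_{AB}(r)` and `c(r)` for `h_{uu}(r)`.  If
`−2 (r·c)′ = r^{−2}(b − (r²·a)′)` and `(r⁴·(r^{−2}·a)′)′ = r²·(r^{−2}·b)′` on
`(0,∞)`, then `r²·c′ − a` is constant on `(0,∞)`; equivalently there is `χ ∈ ℝ`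
with `D^A h_{uA} = r² ∂_r h_{uu} + χ` for all `r > 0`. -/
theorem bondi_mass_aspect_constant (a b c : ℝ → ℝ)
    (ha : ContDiffOn ℝ (⊤ : ℕ∞) a (Set.Ioi 0))
    (hb : ContDiffOn ℝ (⊤ : ℕ∞) b (Set.Ioi 0))
    (hc : ContDiffOn ℝ (⊤ : ℕ∞) c (Set.Ioi 0))
    (h1 : ∀ r ∈ Set.Ioi (0:ℝ),
      -2 * deriv (fun s => s * c s) r
        = (b r - deriv (fun s => s ^ 2 * a s) r) / r ^ 2)
    (h2 : ∀ r ∈ Set.Ioi (0:ℝ),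
      deriv (fun s => s ^ 4 * deriv (fun t => a t / t ^ 2) s) r
        = r ^ 2 * deriv (fun s => b s / s ^ 2) r) :
    ∃ χ : ℝ, ∀ r ∈ Set.Ioi (0:ℝ), a r = r ^ 2 * deriv c r + χ := by
  have smooth_deriv {f : ℝ → ℝ} (hf : ContDiffOn ℝ (⊤ : ℕ∞) f (Set.Ioi 0)) :
      ContDiffOn ℝ (⊤ : ℕ∞) (deriv f) (Set.Ioi 0) :=
    hf.deriv_of_isOpen isOpen_Ioi (by simp)
  have hasDeriv {f : ℝ → ℝ} (hf : ContDiffOn ℝ (⊤ : ℕ∞) f (Set.Ioi 0)) {r : ℝ}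
      (hr : r ∈ Set.Ioi (0 : ℝ)) : HasDerivAt f (deriv f r) r :=
    hf.hasDerivAt_deriv_of_isOpen isOpen_Ioi (by simp) hr
  have mass_eq : ∀ s ∈ Set.Ioi (0 : ℝ), -2 * (c s + s * deriv c s)
      = (b s - (2 * s * a s + s ^ 2 * deriv a s)) / s ^ 2 := by
    intro s hs
    have hsc := ((hasDerivAt_id' s).mul (hasDeriv hc hs)).deriv
    have hsa := ((hasDerivAt_pow 2 s).mul (hasDeriv ha hs)).deriv
    have h := h1 s hs
    simp only [Pi.mul_def] at hsc hsa
    rw [hsc, hsa] at h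
    simpa using h
  have shear_eq : ∀ s ∈ Set.Ioi (0 : ℝ), s ^ 4 * deriv (fun t => a t / t ^ 2) s
      = s ^ 2 * deriv a s - 2 * s * a s := by
    intro s hs
    have hs0 : s ≠ 0 := ne_of_gt hs
    have h := ((hasDeriv ha hs).fun_div (hasDerivAt_pow 2 s) (pow_ne_zero 2 hs0)).deriv
    rw [h]
    field_simp
    norm_num
    ring
  have flux_deriv : ∀ r ∈ Set.Ioi (0 : ℝ),
      HasDerivAt (fun s => a s - s ^ 2 * deriv c s) 0 r := by
    intro r hr
    have hr0 : r ≠ 0 := ne_of_gt hr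
    have near : Set.Ioi (0 : ℝ) ∈ nhds r := isOpen_Ioi.mem_nhds hr
    have da := hasDeriv ha hr
    have db := hasDeriv hb hr
    have dc := hasDeriv hc hr
    have dda := hasDeriv (smooth_deriv ha) hr
    have ddc := hasDeriv (smooth_deriv hc) hr
    have dsq := hasDerivAt_pow 2 r
    have dlin := (hasDerivAt_id' r).const_mul 2
    have mass_deriv := HasDerivAt.unique
      ((dc.fun_add ((hasDerivAt_id' r).fun_mul ddc)).const_mul (-2))
      (((db.fun_sub ((dlin.fun_mul da).fun_add (dsq.fun_mul dda))).fun_div dsq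
        (pow_ne_zero 2 hr0)).congr_of_eventuallyEq (Filter.eventually_of_mem near mass_eq))
    have shear_deriv := h2 r hr
    rw [(((dsq.fun_mul dda).fun_sub (dlin.fun_mul da)).congr_of_eventuallyEq
      (Filter.eventually_of_mem near shear_eq)).deriv,
      (db.fun_div dsq (pow_ne_zero 2 hr0)).deriv] at shear_deriv
    refine (da.fun_sub (dsq.fun_mul ddc)).congr_deriv ?_
    norm_num at mass_deriv shear_deriv ⊢
    field_simp at mass_deriv shear_deriv
    refine mul_left_cancel₀ (pow_ne_zero 2 hr0) ?_
    linear_combination (mass_deriv - shear_deriv) / 2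
  obtain ⟨χ, hχ⟩ := exists_eq_const_of_hasDerivAt_zero_Ioi flux_deriv
  exact ⟨χ, fun r hr => by linarith [hχ r hr]⟩
end
end

section
/- For every C^∞ function f : ℝ → ℝ, the spherical wave u is C^∞ on all of ℝ × ℝ³ (in particular it extends smoothly through the spatial origin) and satisfies the flat wave equation ∂_t² u(t, x) = Σ_{i=1}^{3} ∂²u/∂x_i²(t, x) at every point of ℝ × ℝ³. -/
noncomputable section

open scoped BigOperators

/-- Directional (coordinate) derivative of a function on `ℝ³` along the `i`-th
coordinate direction. -/
def pdE (i : Fin 3) (g : EuclideanSpace ℝ (Fin 3) → ℝ)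
    (x : EuclideanSpace ℝ (Fin 3)) : ℝ :=
  deriv (fun s : ℝ => g (x + s • EuclideanSpace.single i (1:ℝ))) 0

open Classical in
/-- The spherical wave associated with a function `f : ℝ → ℝ`:
`u(t,x) = (f(t−‖x‖) − f(t+‖x‖))/‖x‖` for `x ≠ 0` and `u(t,0) = −2f′(t)`. -/
def sphericalWave (f : ℝ → ℝ) (t : ℝ) (x : EuclideanSpace ℝ (Fin 3)) : ℝ :=
  if x = 0 then -2 * deriv f t else (f (t - ‖x‖) - f (t + ‖x‖)) / ‖x‖

open Filter Topology intervalIntegral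

/-- Unnormalized average of `F` over `[t - r, t + r]` against the weight `(1 - s ^ 2) ^ k`, as a
function of `(t, r)`. -/
def weightedMean (k : ℕ) (F : ℝ → ℝ) (p : ℝ × ℝ) : ℝ :=
  ∫ s in (-1 : ℝ)..1, (1 - s ^ 2) ^ k * F (p.1 + s * p.2)

/-- The weighted mean with `r` the norm of a vector. -/
def radialMean {E : Type*} [Norm E] (k : ℕ) (F : ℝ → ℝ) (p : ℝ × E) : ℝ :=
  weightedMean k F (p.1, ‖p.2‖)

lemma hasDerivAt_comp_line {F : ℝ → ℝ} (hF : Differentiable ℝ F) (t r s : ℝ) :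
    HasDerivAt (fun s => F (t + s * r)) (deriv F (t + s * r) * r) s := by
  have h : HasDerivAt (fun s : ℝ => t + s * r) r s := by
    simpa using ((hasDerivAt_id s).mul_const r).const_add t
  exact (hF (t + s * r)).hasDerivAt.comp s h

lemma ContDiff.deriv_top {F : ℝ → ℝ} (hF : ContDiff ℝ (⊤ : ℕ∞) F) :
    ContDiff ℝ (⊤ : ℕ∞) (deriv F) :=
  (contDiff_infty_iff_deriv.1 hF).2

lemma hasDerivAt_weight (k : ℕ) (s : ℝ) :
    HasDerivAt (fun s : ℝ => (1 - s ^ 2) ^ (k + 1)) (-(2 * (k + 1)) * (s * (1 - s ^ 2) ^ k)) s := by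
  have h := ((hasDerivAt_pow 2 s).const_sub 1).pow (k + 1)
  refine h.congr_deriv ?_
  push_cast
  simp only [pow_one]
  ring

lemma integral_weight_mul_deriv (k : ℕ) {F : ℝ → ℝ} (hF : ContDiff ℝ (⊤ : ℕ∞) F) (p : ℝ × ℝ) :
    ∫ s in (-1 : ℝ)..1, s * (1 - s ^ 2) ^ k * F (p.1 + s * p.2) =
      p.2 / (2 * (k + 1)) * weightedMean (k + 1) (deriv F) p := by
  have hFc := hF.continuous
  have hF'c := hF.deriv_top.continuous
  have h := integral_mul_deriv_eq_deriv_mul (a := -1) (b := 1)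
    (u := fun s => F (p.1 + s * p.2)) (v := fun s : ℝ => (1 - s ^ 2) ^ (k + 1))
    (u' := fun s => deriv F (p.1 + s * p.2) * p.2)
    (v' := fun s : ℝ => -(2 * (k + 1)) * (s * (1 - s ^ 2) ^ k))
    (fun s _ => hasDerivAt_comp_line (hF.differentiable (by simp)) p.1 p.2 s)
    (fun s _ => hasDerivAt_weight k s)
    (Continuous.intervalIntegrable (by fun_prop) _ _)
    (Continuous.intervalIntegrable (by fun_prop) _ _)
  have e1 : ∫ s in (-1 : ℝ)..1, F (p.1 + s * p.2) * (-(2 * (k + 1)) * (s * (1 - s ^ 2) ^ k)) =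
      -(2 * ((k : ℝ) + 1)) * ∫ s in (-1 : ℝ)..1, s * (1 - s ^ 2) ^ k * F (p.1 + s * p.2) := by
    rw [← integral_const_mul]
    congr 1; ext s; ring
  have e2 : ∫ s in (-1 : ℝ)..1, deriv F (p.1 + s * p.2) * p.2 * (1 - s ^ 2) ^ (k + 1) =
      p.2 * weightedMean (k + 1) (deriv F) p := by
    rw [weightedMean, ← integral_const_mul]
    congr 1; ext s; ring
  rw [e1, e2] at h
  norm_num at h
  have hk : (k : ℝ) + 1 ≠ 0 := by positivity
  field_simp
  linarith

lemma hasFDerivAt_weightedMean (k : ℕ) {F : ℝ → ℝ} (hF : ContDiff ℝ (⊤ : ℕ∞) F) (p : ℝ × ℝ) :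
    HasFDerivAt (weightedMean k F)
      (weightedMean k (deriv F) p • ContinuousLinearMap.fst ℝ ℝ ℝ +
        (p.2 / (2 * (k + 1)) * weightedMean (k + 1) (deriv (deriv F)) p) •
          ContinuousLinearMap.snd ℝ ℝ ℝ) p := by
  have hFc := hF.continuous
  have hF'c := hF.deriv_top.continuous
  let F' : ℝ × ℝ → ℝ → ℝ × ℝ →L[ℝ] ℝ := fun q s =>
    ((1 - s ^ 2) ^ k * deriv F (q.1 + s * q.2)) •
      (ContinuousLinearMap.fst ℝ ℝ ℝ + s • ContinuousLinearMap.snd ℝ ℝ ℝ)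
  have hF' : Continuous (fun z : (ℝ × ℝ) × ℝ => F' z.1 z.2) := by
    unfold F'
    fun_prop
  have hF'p : Continuous (F' p) := hF'.comp (Continuous.prodMk_right p)
  obtain ⟨C, hC⟩ := ((isCompact_closedBall p 1).prod (isCompact_Icc (a := (-1 : ℝ)) (b := 1))
    ).exists_bound_of_continuousOn hF'.continuousOn
  have key := hasFDerivAt_integral_of_dominated_of_fderiv_le (μ := MeasureTheory.volume)
    (a := -1) (b := 1)
    (F := fun (q : ℝ × ℝ) s => (1 - s ^ 2) ^ k * F (q.1 + s * q.2)) (F' := F') (x₀ := p)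
    (bound := fun _ => C) (Metric.closedBall_mem_nhds p one_pos)
    (Eventually.of_forall fun q => Continuous.aestronglyMeasurable (by fun_prop))
    (Continuous.intervalIntegrable (by fun_prop) _ _)
    hF'p.aestronglyMeasurable
    (Eventually.of_forall fun s hs q hq => hC (q, s) ⟨hq, by
      rw [Set.uIoc_of_le (by norm_num)] at hs
      exact ⟨hs.1.le, hs.2⟩⟩)
    intervalIntegrable_const
    (Eventually.of_forall fun s _ q _ => by
      have h1 : HasFDerivAt (fun q : ℝ × ℝ => q.1 + s * q.2)
          (ContinuousLinearMap.fst ℝ ℝ ℝ + s • ContinuousLinearMap.snd ℝ ℝ ℝ) q :=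
        hasFDerivAt_fst.add (hasFDerivAt_snd.const_mul s)
      have h2 := ((hF.differentiable (by simp)
        (q.1 + s * q.2)).hasDerivAt.comp_hasFDerivAt q h1).const_mul ((1 - s ^ 2) ^ k)
      rw [smul_smul] at h2
      exact h2)
  refine key.congr_fderiv ?_
  have hint : IntervalIntegrable (F' p) MeasureTheory.volume (-1) 1 := hF'p.intervalIntegrable _ _
  have happ (v : ℝ × ℝ) := ContinuousLinearMap.intervalIntegral_apply hint v
  have hv (v : ℝ × ℝ) : (∫ s in (-1 : ℝ)..1, F' p s) v =
      weightedMean k (deriv F) p * v.1 +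
        p.2 / (2 * (k + 1)) * weightedMean (k + 1) (deriv (deriv F)) p * v.2 := by
    rw [happ, ← integral_weight_mul_deriv k hF.deriv_top, weightedMean, ← integral_mul_const,
      ← integral_mul_const, ← integral_add (Continuous.intervalIntegrable (by fun_prop) _ _)
        (Continuous.intervalIntegrable (by fun_prop) _ _)]
    congr 1; ext s
    simp [F']
    ring
  ext <;> simp [hv]

variable {E : Type*} [NormedAddCommGroup E] [InnerProductSpace ℝ E]

lemma hasFDerivAt_radialMean (k : ℕ) {F : ℝ → ℝ} (hF : ContDiff ℝ (⊤ : ℕ∞) F) (p : ℝ × E) :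
    HasFDerivAt (radialMean k F)
      (radialMean k (deriv F) p • ContinuousLinearMap.fst ℝ ℝ E +
        (radialMean (k + 1) (deriv (deriv F)) p / (2 * (k + 1))) •
          (innerSL ℝ p.2).comp (ContinuousLinearMap.snd ℝ ℝ E)) p := by
  have hW := hasFDerivAt_weightedMean k hF (p.1, ‖p.2‖)
  by_cases hp : p.2 = 0
  · have hlim : Tendsto (fun q : ℝ × E => (q.1, ‖q.2‖)) (𝓝 p) (𝓝 (p.1, ‖p.2‖)) :=
      Continuous.tendsto (by fun_prop) p
    refine HasFDerivAt.of_isLittleO ?_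
    refine ((hW.isLittleO.comp_tendsto hlim).congr_left fun q => ?_).trans_isBigO
      (Asymptotics.IsBigO.of_bound 1 (Eventually.of_forall fun q => ?_))
    · simp [radialMean, hp]
    · simp [hp, Prod.norm_def]
  · have hn : HasFDerivAt (fun x : E => ‖x‖) (‖p.2‖⁻¹ • innerSL ℝ p.2) p.2 := by
      have h := (hasStrictFDerivAt_norm_sq p.2).hasFDerivAt.sqrt (by simpa using hp)
      simp only [Real.sqrt_sq (norm_nonneg _)] at h
      refine h.congr_fderiv ?_
      ext v
      simp
      ring
    have h2 := hW.comp p (hasFDerivAt_fst.prodMk (hn.comp p hasFDerivAt_snd))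
    refine h2.congr_fderiv ?_
    have hp' : ‖p.2‖ ≠ 0 := by simpa using hp
    ext v
    · simp [radialMean]
    · simp [radialMean]
      field_simp

lemma contDiff_radialMean (k : ℕ) {F : ℝ → ℝ} (hF : ContDiff ℝ (⊤ : ℕ∞) F) :
    ContDiff ℝ (⊤ : ℕ∞) (radialMean k F : ℝ × E → ℝ) := by
  refine contDiff_infty.2 fun n => ?_
  induction n generalizing k F with
  | zero =>
    exact contDiff_zero.2
      (continuous_iff_continuousAt.2 fun p => (hasFDerivAt_radialMean k hF p).continuousAt)
  | succ n ih =>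
    refine contDiff_succ_iff_hasFDerivAt.2 ⟨_, ?_, fun p => hasFDerivAt_radialMean k hF p⟩
    have h1 := ih k hF.deriv_top
    have h2 := ih (k + 1) hF.deriv_top.deriv_top
    have h3 : ContDiff ℝ n (fun p : ℝ × E =>
        (innerSL ℝ p.2).comp (ContinuousLinearMap.snd ℝ ℝ E)) :=
      ((innerSL ℝ).contDiff.comp contDiff_snd).clm_comp contDiff_const
    exact (h1.smul contDiff_const).add ((h2.div_const _).smul h3)

/-- The identity behind the Euler–Poisson–Darboux equation for weighted means. -/
lemma weightedMean_zero_eq {F : ℝ → ℝ} (hF : ContDiff ℝ (⊤ : ℕ∞) F) (p : ℝ × ℝ) :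
    weightedMean 0 F p =
      3 / 2 * weightedMean 1 F p + p.2 ^ 2 / 8 * weightedMean 2 (deriv (deriv F)) p := by
  have hFc := hF.continuous
  have hF'c := hF.deriv_top.continuous
  have h1 := integral_weight_mul_deriv 1 hF.deriv_top p
  have h := integral_mul_deriv_eq_deriv_mul (a := -1) (b := 1)
    (v := fun s => F (p.1 + s * p.2)) (u := fun s : ℝ => s * (1 - s ^ 2))
    (u' := fun s => 3 * (1 - s ^ 2) - 2)
    (fun s _ => by
      refine ((hasDerivAt_id s).mul ((hasDerivAt_pow 2 s).const_sub 1)).congr_deriv ?_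
      simp only [id, Nat.cast_ofNat]
      ring)
    (fun s _ => hasDerivAt_comp_line (hF.differentiable (by simp)) p.1 p.2 s)
    (Continuous.intervalIntegrable (by fun_prop) _ _)
    (Continuous.intervalIntegrable (by fun_prop) _ _)
  have e1 : ∫ s in (-1 : ℝ)..1, s * (1 - s ^ 2) * (deriv F (p.1 + s * p.2) * p.2) =
      p.2 * ∫ s in (-1 : ℝ)..1, s * (1 - s ^ 2) ^ 1 * deriv F (p.1 + s * p.2) := by
    rw [← integral_const_mul]
    congr 1; ext s; ring
  have e2 : ∫ s in (-1 : ℝ)..1, (3 * (1 - s ^ 2) - 2) * F (p.1 + s * p.2) =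
      3 * weightedMean 1 F p - 2 * weightedMean 0 F p := by
    rw [weightedMean, weightedMean, ← integral_const_mul, ← integral_const_mul,
      ← integral_sub (Continuous.intervalIntegrable (by fun_prop) _ _)
        (Continuous.intervalIntegrable (by fun_prop) _ _)]
    congr 1; ext s; ring
  rw [e1, h1, e2] at h
  norm_num at h
  linarith

lemma sphericalWave_eq_radialMean {f : ℝ → ℝ} (hf : ContDiff ℝ (⊤ : ℕ∞) f) (t : ℝ)
    (x : EuclideanSpace ℝ (Fin 3)) :
    sphericalWave f t x = -radialMean 0 (deriv f) (t, x) := by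
  have hf'c := hf.deriv_top.continuous
  by_cases hx : x = 0
  · simp [sphericalWave, radialMean, weightedMean, hx]
    norm_num
  · have hn : ‖x‖ ≠ 0 := by simpa using hx
    have h := integral_eq_sub_of_hasDerivAt (a := -1) (b := 1)
      (fun s _ => hasDerivAt_comp_line (hf.differentiable (by simp)) t ‖x‖ s)
      (Continuous.intervalIntegrable (by fun_prop) _ _)
    rw [integral_mul_const] at h
    simp only [sphericalWave, radialMean, weightedMean, hx, if_false, pow_zero, one_mul]
    rw [div_eq_iff hn, neg_mul, h]
    ring_nf

lemma hasDerivAt_radialMean_time (k : ℕ) {F : ℝ → ℝ} (hF : ContDiff ℝ (⊤ : ℕ∞) F) (t : ℝ)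
    (x : E) : HasDerivAt (fun s => radialMean k F (s, x)) (radialMean k (deriv F) (t, x)) t := by
  have h := (hasFDerivAt_radialMean k hF (t, x)).comp_hasDerivAt t
    ((hasDerivAt_id t).prodMk (hasDerivAt_const t x))
  exact h.congr_deriv (by simp)

lemma hasDerivAt_radialMean_coord (k : ℕ) {F : ℝ → ℝ} (hF : ContDiff ℝ (⊤ : ℕ∞) F) (t : ℝ)
    (x : EuclideanSpace ℝ (Fin 3)) (i : Fin 3) :
    HasDerivAt (fun s : ℝ => radialMean k F (t, x + s • EuclideanSpace.single i (1 : ℝ)))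
      (radialMean (k + 1) (deriv (deriv F)) (t, x) / (2 * (k + 1)) * x i) 0 := by
  have hl : HasDerivAt (fun s : ℝ => x + s • EuclideanSpace.single i (1 : ℝ))
      (EuclideanSpace.single i (1 : ℝ)) 0 := by
    simpa using ((hasDerivAt_id (0 : ℝ)).smul_const (EuclideanSpace.single i (1 : ℝ))).const_add x
  have h := HasFDerivAt.comp_hasDerivAt_of_eq 0 (hasFDerivAt_radialMean k hF (t, x))
    ((hasDerivAt_const (0 : ℝ) t).prodMk hl) (by simp)
  exact h.congr_deriv (by simp [EuclideanSpace.inner_single_right])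

/-- for every `C^∞` function `f`, the spherical wave is `C^∞` on
all of `ℝ × ℝ³` (in particular it extends smoothly through the spatial origin)
and satisfies the flat wave equation `∂_t²u = Σᵢ ∂ᵢ²u` everywhere. -/
theorem sphericalWave_smooth_and_wave (f : ℝ → ℝ) (hf : ContDiff ℝ (⊤ : ℕ∞) f) :
    ContDiff ℝ (⊤ : ℕ∞) (fun p : ℝ × EuclideanSpace ℝ (Fin 3) =>
        sphericalWave f p.1 p.2) ∧
      ∀ (t : ℝ) (x : EuclideanSpace ℝ (Fin 3)),
        deriv (deriv (fun s => sphericalWave f s x)) t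
          = ∑ i : Fin 3, pdE i (pdE i (sphericalWave f t)) x := by
  have hf1 := hf.deriv_top
  have hf3 := hf1.deriv_top.deriv_top
  have hu : sphericalWave f = fun t x => -radialMean 0 (deriv f) (t, x) :=
    funext fun t => funext fun x => sphericalWave_eq_radialMean hf t x
  rw [hu]
  refine ⟨(contDiff_radialMean 0 hf1).neg, fun t x => ?_⟩
  have hderiv : deriv (fun s => -radialMean 0 (deriv f) (s, x)) =
      fun s => -radialMean 0 (deriv (deriv f)) (s, x) :=
    funext fun s => (hasDerivAt_radialMean_time 0 hf1 s x).neg.deriv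
  have htime : deriv (deriv (fun s => -radialMean 0 (deriv f) (s, x))) t =
      -radialMean 0 (deriv (deriv (deriv f))) (t, x) := by
    rw [hderiv]
    exact (hasDerivAt_radialMean_time 0 hf1.deriv_top t x).neg.deriv
  have hgrad (i : Fin 3) : pdE i (fun y => -radialMean 0 (deriv f) (t, y)) =
      fun y => -(radialMean 1 (deriv (deriv (deriv f))) (t, y) / 2 * y i) := by
    funext y
    have h := (hasDerivAt_radialMean_coord 0 hf1 t y i).neg.deriv
    simpa [pdE] using h
  have hspace (i : Fin 3) : pdE i (pdE i (fun y => -radialMean 0 (deriv f) (t, y))) x =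
      -(radialMean 2 (deriv (deriv (deriv (deriv (deriv f))))) (t, x) / 8 * x i ^ 2 +
        radialMean 1 (deriv (deriv (deriv f))) (t, x) / 2) := by
    have hl : HasDerivAt (fun s : ℝ => (x + s • EuclideanSpace.single i (1 : ℝ)) i) 1 0 := by
      simpa using (hasDerivAt_id (0 : ℝ)).const_add (x i)
    have h := (((hasDerivAt_radialMean_coord 1 hf3 t x i).div_const 2).mul hl).neg.deriv
    rw [hgrad]
    refine h.trans ?_
    simp
    ring
  rw [htime, Finset.sum_congr rfl fun i _ => hspace i]
  have hid := weightedMean_zero_eq hf3 (t, ‖x‖)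
  simp only [EuclideanSpace.norm_sq_eq, Real.norm_eq_abs, sq_abs, Fin.sum_univ_three] at hid
  simp only [radialMean, Fin.sum_univ_three]
  rw [hid]
  ring
end
end

section
/- Under the Bondi trace conditions Tr( g(r)⁻¹ h₁(r) ) = 0 = Tr( g(r)⁻¹ h₂(r) ) for all r, the presymplectic integrand simplifies: for every r, W(r) = (e^{−2β(r)}/2) ( Tr( g⁻¹ h₂ g⁻¹ h₁′ ) − Tr( g⁻¹ h₁ g⁻¹ h₂′ ) )(r). In particular W is independent of the functions p₁ and p₂. -/
noncomputable section

open scoped BigOperators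

/-- Differentiating the trace condition `Tr(G h) = 0`, where `g G = 1`, gives
`Tr(G h′) = Tr(G h G g′)`. -/
theorem trace_inv_mul_deriv_eq_of_trace_inv_mul_eq_zero
    (g h G : ℝ → Fin 2 → Fin 2 → ℝ)
    (hg : ∀ a b, Differentiable ℝ (fun r => g r a b))
    (hh : ∀ a b, Differentiable ℝ (fun r => h r a b))
    (hinv : ∀ r a c, (∑ b, g r a b * G r b c) = if a = c then (1:ℝ) else 0)
    (htr : ∀ r, (∑ a, ∑ b, G r a b * h r b a) = 0) (r : ℝ) :
    (∑ a, ∑ b, G r a b * deriv (fun s => h s b a) r) =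
      ∑ a, ∑ b, ∑ c, ∑ d, G r a b * h r b c * G r c d * deriv (fun s => g s d a) r := by
  have inv_entries : ∀ s, g s 0 0 * G s 0 0 + g s 0 1 * G s 1 0 = 1 ∧
      g s 0 0 * G s 0 1 + g s 0 1 * G s 1 1 = 0 ∧
      g s 1 0 * G s 0 0 + g s 1 1 * G s 1 0 = 0 ∧
      g s 1 0 * G s 0 1 + g s 1 1 * G s 1 1 = 1 := fun s =>
    ⟨by simpa using hinv s 0 0, by simpa using hinv s 0 1,
      by simpa using hinv s 1 0, by simpa using hinv s 1 1⟩
  simp only [Fin.sum_univ_two] at htr ⊢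
  have adj_trace : ∀ s, g s 1 1 * h s 0 0 - g s 0 1 * h s 1 0
      - g s 1 0 * h s 0 1 + g s 0 0 * h s 1 1 = 0 := by
    intro s
    obtain ⟨e1, e2, e3, e4⟩ := inv_entries s
    have t := htr s
    generalize g s 0 0 = a at *
    generalize g s 0 1 = b at *
    generalize g s 1 0 = c at *
    generalize g s 1 1 = d at *
    have f00 : d = (a * d - b * c) * G s 0 0 := by linear_combination (-d) * e1 + b * e3
    have f01 : -b = (a * d - b * c) * G s 0 1 := by linear_combination (-d) * e2 + b * e4
    have f10 : -c = (a * d - b * c) * G s 1 0 := by linear_combination c * e1 - a * e3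
    have f11 : a = (a * d - b * c) * G s 1 1 := by linear_combination c * e2 - a * e4
    linear_combination (a * d - b * c) * t + h s 0 0 * f00 + h s 1 0 * f01
      + h s 0 1 * f10 + h s 1 1 * f11
  have dg := fun a b => (hg a b r).hasDerivAt
  have dh := fun a b => (hh a b r).hasDerivAt
  have hd := ((((dg 1 1).mul (dh 0 0)).sub ((dg 0 1).mul (dh 1 0))).sub
    ((dg 1 0).mul (dh 0 1))).add ((dg 0 0).mul (dh 1 1))
  have adj_trace_deriv := hd.unique
    ((hasDerivAt_const r (0 : ℝ)).congr_of_eventuallyEq (Filter.Eventually.of_forall adj_trace))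
  obtain ⟨e1, e2, e3, e4⟩ := inv_entries r
  have t := htr r
  generalize deriv (fun s => g s 0 0) r = g00' at *
  generalize deriv (fun s => g s 0 1) r = g01' at *
  generalize deriv (fun s => g s 1 0) r = g10' at *
  generalize deriv (fun s => g s 1 1) r = g11' at *
  generalize deriv (fun s => h s 0 0) r = h00' at *
  generalize deriv (fun s => h s 0 1) r = h01' at *
  generalize deriv (fun s => h s 1 0) r = h10' at *
  generalize deriv (fun s => h s 1 1) r = h11' at *
  generalize g r 0 0 = a at *
  generalize g r 0 1 = b at *
  generalize g r 1 0 = c at *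
  generalize g r 1 1 = d at *
  set y := G r 0 0 * G r 1 1 - G r 0 1 * G r 1 0 with hy
  have k00 : G r 0 0 = d * y := by linear_combination G r 0 1 * e3 - G r 0 0 * e4 + d * hy
  have k01 : G r 0 1 = -b * y := by linear_combination G r 0 0 * e2 - G r 0 1 * e1 + b * hy
  have k10 : G r 1 0 = -c * y := by linear_combination G r 1 1 * e3 - G r 1 0 * e4 + c * hy
  have k11 : G r 1 1 = a * y := by linear_combination G r 1 0 * e2 - G r 1 1 * e1 + a * hy
  -- Polarised Cayley–Hamilton: `Tr(G h G g′) = Tr(G h) Tr(G g′) - det G * Tr(adj(g′) h)`.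
  linear_combination y * adj_trace_deriv + h00' * k00 + h10' * k01 + h01' * k10 + h11' * k11
    - (G r 0 0 * g00' + G r 0 1 * g10' + G r 1 0 * g01' + G r 1 1 * g11') * t
    + (g11' * h r 0 0 - g01' * h r 1 0 - g10' * h r 0 1 + g00' * h r 1 1) * hy

/-- under the Bondi trace conditions `Tr(g⁻¹h₁) = 0 = Tr(g⁻¹h₂)`,
the `u`-component of the presymplectic current on a null hypersurface,
`W = (e^{−4β}/2)[p₂Tr(g⁻¹h₁′) − p₁Tr(g⁻¹h₂′)
      + Tr(g⁻¹h₂g⁻¹(e^{2β}h₁′ + p₁g′)) − Tr(g⁻¹h₁g⁻¹(e^{2β}h₂′ + p₂g′))]`,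
simplifies for every `r` to
`W = (e^{−2β}/2)(Tr(g⁻¹h₂g⁻¹h₁′) − Tr(g⁻¹h₁g⁻¹h₂′))`;
in particular `W` is independent of `p₁` and `p₂`. -/
theorem presymplectic_current_Bondi_simplification
    (g h1 h2 Ginv : ℝ → Fin 2 → Fin 2 → ℝ) (β p1 p2 : ℝ → ℝ)
    (hgdiff : ∀ a b, Differentiable ℝ (fun r => g r a b))
    (hh1diff : ∀ a b, Differentiable ℝ (fun r => h1 r a b))
    (hh2diff : ∀ a b, Differentiable ℝ (fun r => h2 r a b))
    (hgsym : ∀ r a b, g r a b = g r b a)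
    (hh1sym : ∀ r a b, h1 r a b = h1 r b a)
    (hh2sym : ∀ r a b, h2 r a b = h2 r b a)
    (hinv : ∀ r a c, (∑ b, g r a b * Ginv r b c) = if a = c then (1:ℝ) else 0)
    (htr1 : ∀ r, (∑ a, ∑ b, Ginv r a b * h1 r b a) = 0)
    (htr2 : ∀ r, (∑ a, ∑ b, Ginv r a b * h2 r b a) = 0) :
    ∀ r : ℝ,
      Real.exp (-(4 * β r)) / 2 *
        (p2 r * (∑ a, ∑ b, Ginv r a b * deriv (fun s => h1 s b a) r)
          - p1 r * (∑ a, ∑ b, Ginv r a b * deriv (fun s => h2 s b a) r)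
          + (∑ a, ∑ b, ∑ c, ∑ d, Ginv r a b * h2 r b c * Ginv r c d *
              (Real.exp (2 * β r) * deriv (fun s => h1 s d a) r
                + p1 r * deriv (fun s => g s d a) r))
          - (∑ a, ∑ b, ∑ c, ∑ d, Ginv r a b * h1 r b c * Ginv r c d *
              (Real.exp (2 * β r) * deriv (fun s => h2 s d a) r
                + p2 r * deriv (fun s => g s d a) r)))
      = Real.exp (-(2 * β r)) / 2 *
          ((∑ a, ∑ b, ∑ c, ∑ d,
              Ginv r a b * h2 r b c * Ginv r c d * deriv (fun s => h1 s d a) r)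
            - ∑ a, ∑ b, ∑ c, ∑ d,
                Ginv r a b * h1 r b c * Ginv r c d * deriv (fun s => h2 s d a) r) := by
  intro r
  have k1 := trace_inv_mul_deriv_eq_of_trace_inv_mul_eq_zero g h1 Ginv hgdiff hh1diff hinv htr1 r
  have k2 := trace_inv_mul_deriv_eq_of_trace_inv_mul_eq_zero g h2 Ginv hgdiff hh2diff hinv htr2 r
  have hexp : Real.exp (-(4 * β r)) * Real.exp (2 * β r) = Real.exp (-(2 * β r)) := by
    rw [← Real.exp_add]
    ring_nf
  have split : ∀ (h k : Fin 2 → Fin 2 → ℝ) (p : ℝ),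
      (∑ a, ∑ b, ∑ c, ∑ d, Ginv r a b * h b c * Ginv r c d *
        (Real.exp (2 * β r) * k d a + p * deriv (fun s => g s d a) r)) =
      Real.exp (2 * β r) * (∑ a, ∑ b, ∑ c, ∑ d, Ginv r a b * h b c * Ginv r c d * k d a) +
        p * ∑ a, ∑ b, ∑ c, ∑ d,
          Ginv r a b * h b c * Ginv r c d * deriv (fun s => g s d a) r := by
    intro h k p
    simp only [Finset.mul_sum, ← Finset.sum_add_distrib]
    refine Finset.sum_congr rfl fun a _ => Finset.sum_congr rfl fun b _ =>
      Finset.sum_congr rfl fun c _ => Finset.sum_congr rfl fun d _ => ?_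
    ring
  rw [split (h2 r) (fun d a => deriv (fun s => h1 s d a) r),
    split (h1 r) (fun d a => deriv (fun s => h2 s d a) r), k1, k2, ← hexp]
  ring
end
end
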